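/- arXiv:1911.06054 — 2 statements merged into one kernel-verified Lean document; each statement's English description precedes it below -/
import Mathlib

section
/- Let G be a finite group such that the commutator subgroup G' has prime order p and G' ∩ Z(G) is trivial. Then G is a CG-group. -/
/-- The set of element centralizers of a group `G`. -/
def Cent (G : Type*) [Group G] : Set (Subgroup G) :=
  Set.range fun x : G => Subgroup.centralizer {x}

/-- A finite group `G` is a CG-group if `|Cent(G)| = |G'| + 2`,
where `G'` is the commutator subgroup. -/
def IsCGGroup (G : Type*) [Group G] : Prop :=
  (Cent G).ncard = Nat.card (commutator G) + 2

section CommutatorPrimeOrder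

open Subgroup

variable {G : Type*} [Group G]

theorem mul_inv_mem_commutator (x y : G) : x * y * x⁻¹ * y⁻¹ ∈ commutator G :=
  commutator_mem_commutator (mem_top x) (mem_top y)

theorem Commute.of_mem_of_prime_card {N : Subgroup G} (hN : (Nat.card N).Prime) {x n m : G}
    (hn : n ∈ N) (hn1 : n ≠ 1) (hx : Commute x n) (hm : m ∈ N) : Commute x m := by
  have : Fact (Nat.card N).Prime := ⟨hN⟩
  have h := mem_zpowers_of_prime_card (g := (⟨n, hn⟩ : N)) (g' := ⟨m, hm⟩) rfl
    (by simpa [Subtype.ext_iff] using hn1)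
  obtain ⟨k, hk⟩ := mem_zpowers_iff.1 h
  have hk' : n ^ k = m := by simpa [Subtype.ext_iff] using hk
  exact hk' ▸ hx.zpow_right k

theorem eq_one_of_commute_of_notMem_centralizer {N : Subgroup G} (hN : (Nat.card N).Prime)
    {x n : G} (hx : x ∉ centralizer (N : Set G)) (hn : n ∈ N) (h : Commute x n) : n = 1 := by
  by_contra hn1
  exact hx (mem_centralizer_iff.2 fun m hm =>
    (Commute.of_mem_of_prime_card hN hn hn1 h hm).symm.eq)

theorem le_centralizer_of_prime_card {N : Subgroup G} (hN : (Nat.card N).Prime) :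
    N ≤ centralizer (N : Set G) := by
  intro x hx
  by_contra h
  exact h (eq_one_of_commute_of_notMem_centralizer hN h hx (Commute.refl x) ▸ one_mem _)

theorem conj_injOn_of_notMem_centralizer {N : Subgroup G} (hN : (Nat.card N).Prime)
    {x n m : G} (hx : x ∉ centralizer (N : Set G)) (hn : n ∈ N) (hm : m ∈ N)
    (h : n * x * n⁻¹ = m * x * m⁻¹) : n = m := by
  refine (inv_mul_eq_one.1 (eq_one_of_commute_of_notMem_centralizer hN hx
    (mul_mem (inv_mem hm) hn) ?_)).symm
  have h' : n * x = m * x * m⁻¹ * n := by rw [← h]; group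
  change x * (m⁻¹ * n) = m⁻¹ * n * x
  rw [mul_assoc m⁻¹, h']
  group

theorem exists_conj_eq_of_mul_inv_mem_commutator [Finite G]
    (hN : (Nat.card (commutator G)).Prime) {x y : G}
    (hx : x ∉ centralizer (commutator G : Set G)) (h : y * x⁻¹ ∈ commutator G) :
    ∃ n ∈ commutator G, n * x * n⁻¹ = y := by
  let f : commutator G → commutator G := fun n => ⟨n * x * n⁻¹ * x⁻¹, mul_inv_mem_commutator _ _⟩
  have hf : Function.Injective f := fun n m hnm =>
    Subtype.ext (conj_injOn_of_notMem_centralizer hN hx n.2 m.2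
      (mul_right_cancel (congrArg Subtype.val hnm)))
  obtain ⟨n, hn⟩ := Finite.surjective_of_injective hf ⟨y * x⁻¹, h⟩
  exact ⟨n, n.2, mul_right_cancel (congrArg Subtype.val hn)⟩

theorem exists_eq_mul_commute_of_notMem_centralizer [Finite G]
    (hN : (Nat.card (commutator G)).Prime) {x : G}
    (hx : x ∉ centralizer (commutator G : Set G)) (g : G) :
    ∃ n ∈ commutator G, ∃ h, Commute x h ∧ g = n * h := by
  obtain ⟨n, hn, hnx⟩ :=
    exists_conj_eq_of_mul_inv_mem_commutator hN hx (mul_inv_mem_commutator g x)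
  refine ⟨n, hn, n⁻¹ * g, ?_, by group⟩
  have h' : x = n⁻¹ * (g * x * g⁻¹) * n := by rw [← hnx]; group
  change x * (n⁻¹ * g) = n⁻¹ * g * x
  nth_rw 1 [h']
  group

theorem Commute.of_commute_notMem_centralizer_commutator
    (hN : (Nat.card (commutator G)).Prime) {x y z : G}
    (hx : x ∉ centralizer (commutator G : Set G)) (hy : Commute x y) (hz : Commute x z) :
    Commute y z := by
  have h := eq_one_of_commute_of_notMem_centralizer hN hx (mul_inv_mem_commutator y z)
    (((hy.mul_right hz).mul_right hy.inv_right).mul_right hz.inv_right)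
  exact mul_inv_eq_iff_eq_mul.1 (mul_inv_eq_one.1 h)

theorem mem_centralizer_singleton_iff_commute {x g : G} :
    g ∈ centralizer ({x} : Set G) ↔ Commute x g := by
  rw [mem_centralizer_singleton_iff]
  exact eq_comm

theorem centralizer_eq_of_commute_of_notMem (hN : (Nat.card (commutator G)).Prime) {x y : G}
    (hx : x ∉ centralizer (commutator G : Set G)) (hy : y ∉ centralizer (commutator G : Set G))
    (h : Commute x y) : centralizer ({x} : Set G) = centralizer {y} := by
  ext g
  simp only [mem_centralizer_singleton_iff_commute]
  exact ⟨h.of_commute_notMem_centralizer_commutator hN hx,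
    h.symm.of_commute_notMem_centralizer_commutator hN hy⟩

theorem centralizer_singleton_eq_of_prime_card {N : Subgroup G} (hN : (Nat.card N).Prime) {n : G}
    (hn : n ∈ N) (hn1 : n ≠ 1) : centralizer ({n} : Set G) = centralizer (N : Set G) := by
  ext g
  rw [mem_centralizer_singleton_iff_commute]
  exact ⟨fun h => mem_centralizer_iff.2 fun m hm =>
      (Commute.of_mem_of_prime_card hN hn hn1 h.symm hm).symm.eq,
    fun h => mem_centralizer_iff.1 h n hn⟩

theorem conj_notMem_centralizer {N : Subgroup G} [N.Normal] {x : G}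
    (hx : x ∉ centralizer (N : Set G)) (n : G) : n * x * n⁻¹ ∉ centralizer (N : Set G) :=
  fun h => hx (by
    simpa [mul_assoc] using
      (inferInstance : (centralizer (N : Set G)).Normal).conj_mem _ h n⁻¹)

theorem Cent_eq_of_prime_card_commutator [Finite G] (hN : (Nat.card (commutator G)).Prime)
    {x : G} (hx : x ∉ centralizer (commutator G : Set G)) :
    Cent G = insert ⊤ (insert (centralizer (commutator G : Set G))
      (Set.range fun n : commutator G => centralizer {(n : G) * x * (n : G)⁻¹})) := by
  have hle := le_centralizer_of_prime_card hN
  apply Set.Subset.antisymm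
  · rintro _ ⟨y, rfl⟩
    obtain ⟨n, hn, h, hh, rfl⟩ := exists_eq_mul_commute_of_notMem_centralizer hN hx y
    by_cases hhC : h ∈ centralizer (commutator G : Set G)
    · have hcen : ∀ g, Commute h g := by
        intro g
        obtain ⟨m, hm, k, hk, rfl⟩ := exists_eq_mul_commute_of_notMem_centralizer hN hx g
        exact Commute.mul_right (mem_centralizer_iff.1 hhC m hm).symm
          (hh.of_commute_notMem_centralizer_commutator hN hx hk)
      have heq : centralizer ({n * h} : Set G) = centralizer {n} := by
        ext g
        simp only [mem_centralizer_singleton_iff_commute]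
        refine ⟨fun hg => ?_, fun hg => hg.mul_left (hcen g)⟩
        simpa using hg.mul_left (hcen g).inv_left
      by_cases hn1 : n = 1
      · left
        simp only [heq]
        rw [hn1]
        exact centralizer_eq_top_iff_subset.2 (by simp)
      · right; left
        simp only [heq]
        exact centralizer_singleton_eq_of_prime_card hN hn hn1
    · right; right
      have hnh : n * h ∉ centralizer (commutator G : Set G) := fun H =>
        hhC ((mul_mem_cancel_left (hle hn)).1 H)
      obtain ⟨m, hm, hmh⟩ := exists_conj_eq_of_mul_inv_mem_commutator (y := n * h) hN hhC
        (by simpa using hn)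
      refine ⟨⟨m, hm⟩, centralizer_eq_of_commute_of_notMem hN (conj_notMem_centralizer hx m) hnh ?_⟩
      rw [← hmh]
      exact (Commute.conj_iff m).2 hh
  · rintro _ (rfl | rfl | ⟨n, rfl⟩)
    · exact ⟨1, centralizer_eq_top_iff_subset.2 (by simp)⟩
    · obtain ⟨n, hn1⟩ := (commutator G).ne_bot_iff_exists_ne_one.1
        (fun h => hN.ne_one (by simp [h]))
      exact ⟨n, centralizer_singleton_eq_of_prime_card hN n.2 (by simpa using hn1)⟩
    · exact ⟨_, rfl⟩

end CommutatorPrimeOrder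

/-- If `|G'| = p` is prime and `G' ∩ Z(G) = 1`, then `G` is a CG-group. -/
theorem isCGGroup_of_commutator_prime_order (G : Type*) [Group G] [Finite G]
    (p : ℕ) (hp : p.Prime) (hcomm : Nat.card (commutator G) = p)
    (hint : commutator G ⊓ Subgroup.center G = ⊥) :
    IsCGGroup G := by
  subst hcomm
  obtain ⟨⟨a, ha⟩, ha1⟩ := (commutator G).ne_bot_iff_exists_ne_one.1
    (fun h => hp.ne_one (by simp [h]))
  replace ha1 : a ≠ 1 := by simpa using ha1
  obtain ⟨x, hx⟩ : ∃ x, x ∉ Subgroup.centralizer (commutator G : Set G) := by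
    by_contra! hall
    refine ha1 (Subgroup.mem_bot.1 (hint ▸ Subgroup.mem_inf.2 ⟨ha, ?_⟩))
    exact Subgroup.mem_center_iff.2 fun g => (Subgroup.mem_centralizer_iff.1 (hall g) a ha).symm
  have hconj := fun n : G => conj_notMem_centralizer hx n
  have haC := le_centralizer_of_prime_card hp ha
  have hf : Function.Injective fun n : commutator G =>
      Subgroup.centralizer {(n : G) * x * (n : G)⁻¹} := by
    intro n m hnm
    refine Subtype.ext (conj_injOn_of_notMem_centralizer hp hx n.2 m.2 ?_)
    have hc : Commute ((n : G) * x * (n : G)⁻¹) ((m : G) * x * (m : G)⁻¹) := by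
      rw [← mem_centralizer_singleton_iff_commute]
      exact hnm.ge (mem_centralizer_singleton_iff_commute.2 (Commute.refl _))
    refine mul_inv_eq_one.1 (eq_one_of_commute_of_notMem_centralizer hp (hconj m) ?_
      (hc.symm.mul_right (Commute.refl _).inv_right))
    have h := mul_mem (mul_inv_mem_commutator (n : G) x)
      (inv_mem (mul_inv_mem_commutator (m : G) x))
    simpa [mul_assoc] using h
  have hnot : ∀ n : G, a ∉ Subgroup.centralizer {n * x * n⁻¹} := fun n h =>
    ha1 (eq_one_of_commute_of_notMem_centralizer hp (hconj n) ha
      (mem_centralizer_singleton_iff_commute.1 h))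
  rw [IsCGGroup, Cent_eq_of_prime_card_commutator hp hx, Set.ncard_insert_of_notMem,
    Set.ncard_insert_of_notMem, Set.ncard_range_of_injective hf]
  · rintro ⟨n, hn⟩
    exact hnot n (hn.ge haC)
  · rintro (h | ⟨n, hn⟩)
    · exact hx (h ▸ Subgroup.mem_top x)
    · exact hnot n (hn.ge (Subgroup.mem_top a))
end

section
/- Let G be a finite group such that |G/Z(G)| = p³ for some prime p. Then G is a CG-group if and only if G has an abelian normal subgroup of prime index. -/
section Aux

open Subgroup
open scoped commutatorElement

variable {G : Type*} [Group G]

theorem Subgroup.eq_top_of_index_prime {N M : Subgroup G} (hN : N.index.Prime) (hNM : N ≤ M)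
    {g : G} (hgN : g ∉ N) (hgM : g ∈ M) : M = ⊤ := by
  have h := relIndex_mul_index hNM
  rcases (Nat.dvd_prime hN).1 (Dvd.intro_left _ h) with h1 | h1
  · exact index_eq_one.1 h1
  · rw [h1] at h
    have h2 : N.relIndex M = 1 := Nat.eq_of_mul_eq_mul_right hN.pos (by rw [h, one_mul])
    exact absurd (relIndex_eq_one.1 h2 hgM) hgN

/-- The homomorphism `a ↦ ⁅a, g⁆` from an abelian normal subgroup. -/
def commutatorHom (N : Subgroup G) [N.Normal] (hN : ∀ x ∈ N, ∀ y ∈ N, x * y = y * x) (g : G) :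
    N →* G where
  toFun a := ⁅(a : G), g⁆
  map_one' := by simp
  map_mul' := by
    rintro ⟨a, ha⟩ ⟨b, hb⟩
    have h1 : g * a⁻¹ * g⁻¹ ∈ N := Normal.conj_mem ‹_› _ (N.inv_mem ha) g
    have h2 : b * (g * b⁻¹ * g⁻¹) ∈ N :=
      N.mul_mem hb (Normal.conj_mem ‹_› _ (N.inv_mem hb) g)
    have h := hN _ h2 _ h1
    simp only [commutatorElement_def]
    calc a * b * g * (a * b)⁻¹ * g⁻¹
        = a * ((b * (g * b⁻¹ * g⁻¹)) * (g * a⁻¹ * g⁻¹)) := by group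
      _ = a * ((g * a⁻¹ * g⁻¹) * (b * (g * b⁻¹ * g⁻¹))) := by rw [h]
      _ = _ := by group

theorem commutatorHom_apply (N : Subgroup G) [N.Normal]
    (hN : ∀ x ∈ N, ∀ y ∈ N, x * y = y * x) (g : G) (a : N) :
    commutatorHom N hN g a = ⁅(a : G), g⁆ := rfl

section AbelianPrimeIndex

variable {N : Subgroup G} [hn : N.Normal] (hN : ∀ x ∈ N, ∀ y ∈ N, x * y = y * x)
  (hp : N.index.Prime) {g : G} (hg : g ∉ N)

include hp hg

theorem commutatorHom_range_normal : (commutatorHom N hN g).range.Normal := by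
  rw [← normalizer_eq_top_iff]
  have key : ∀ a ∈ N, ⁅a, g⁆ ∈ N := fun a ha => by
    have := N.mul_mem ha (hn.conj_mem _ (N.inv_mem ha) g)
    rwa [← mul_assoc, ← mul_assoc] at this
  refine eq_top_of_index_prime hp (fun b hb => ?_) hg ?_
  · rw [mem_normalizer_iff]
    have hfix : ∀ c ∈ N, ∀ k ∈ N, c * k * c⁻¹ = k := fun c hc k hk => by
      rw [hN c hc k hk, mul_inv_cancel_right]
    have hle : ∀ k ∈ (commutatorHom N hN g).range, k ∈ N := by
      rintro _ ⟨a, rfl⟩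
      exact key a a.2
    intro k
    constructor
    · intro hk
      rwa [hfix b hb k (hle k hk)]
    · intro hk
      have h := hfix b⁻¹ (N.inv_mem hb) _ (hle _ hk)
      have h2 : b * k * b⁻¹ = k := by
        rw [← h]
        group
      rwa [h2] at hk
  · rw [mem_normalizer_iff]
    intro k
    constructor
    · rintro ⟨a, rfl⟩
      refine ⟨⟨g * a * g⁻¹, hn.conj_mem _ a.2 g⟩, ?_⟩
      simp only [commutatorHom_apply, commutatorElement_def]
      group
    · rintro ⟨b, hb⟩
      refine ⟨⟨g⁻¹ * b * g, by simpa using hn.conj_mem _ b.2 g⁻¹⟩, ?_⟩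
      have h : k = g⁻¹ * (commutatorHom N hN g b) * g := by
        rw [hb]
        group
      rw [h]
      simp only [commutatorHom_apply, commutatorElement_def]
      group

theorem commutatorHom_range_eq_commutator : (commutatorHom N hN g).range = _root_.commutator G := by
  apply le_antisymm
  · rintro _ ⟨a, rfl⟩
    exact commutator_mem_commutator (mem_top _) (mem_top _)
  · have := commutatorHom_range_normal hN hp hg
    set K := (commutatorHom N hN g).range
    let π := QuotientGroup.mk' K
    have hπ : ∀ a ∈ N, π a * π g = π g * π a := fun a ha => by
      rw [← commutatorElement_eq_one_iff_mul_comm, ← map_commutatorElement]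
      exact (QuotientGroup.eq_one_iff _).2 ⟨⟨a, ha⟩, rfl⟩
    have hcent : ∀ x, (x ∈ N ∨ x = g) → ∀ y, π y * π x = π x * π y := by
      intro x hx
      have h : (centralizer {π x}).comap π = ⊤ := by
        refine eq_top_of_index_prime hp (fun b hb => ?_) hg ?_
        · rw [mem_comap, mem_centralizer_singleton_iff]
          rcases hx with hx | rfl
          · rw [← map_mul, ← map_mul, hN b hb x hx]
          · exact hπ b hb
        · rw [mem_comap, mem_centralizer_singleton_iff]
          rcases hx with hx | rfl
          · exact (hπ x hx).symm
          · rfl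
      intro y
      have hy : y ∈ (centralizer {π x}).comap π := h ▸ mem_top y
      rwa [mem_comap, mem_centralizer_singleton_iff] at hy
    have hall : ∀ y x, π y * π x = π x * π y := by
      intro y
      have h : (centralizer {π y}).comap π = ⊤ := by
        refine eq_top_of_index_prime hp (fun b hb => ?_) hg ?_ <;>
          rw [mem_comap, mem_centralizer_singleton_iff]
        · exact (hcent b (Or.inl hb) y).symm
        · exact (hcent g (Or.inr rfl) y).symm
      intro x
      have hx : x ∈ (centralizer {π y}).comap π := h ▸ mem_top x
      rw [mem_comap, mem_centralizer_singleton_iff] at hx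
      exact hx.symm
    rw [_root_.commutator_def, Subgroup.commutator_le]
    intro x _ y _
    rw [← QuotientGroup.eq_one_iff (N := K)]
    change π ⁅x, y⁆ = 1
    rw [map_commutatorElement, commutatorElement_eq_one_iff_mul_comm]
    exact hall x y

include hN in
theorem card_commutator_eq_relIndex_center :
    Nat.card (commutator G) = (center G).relIndex N := by
  rw [← commutatorHom_range_eq_commutator hN hp hg, ← index_ker, relIndex]
  congr 1
  ext ⟨a, ha⟩
  rw [MonoidHom.mem_ker, mem_subgroupOf, commutatorHom_apply,
    commutatorElement_eq_one_iff_mul_comm]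
  constructor
  · intro h
    have htop : centralizer {a} = ⊤ := by
      refine eq_top_of_index_prime hp (fun b hb => ?_) hg ?_ <;>
        rw [mem_centralizer_singleton_iff]
      · exact hN b hb a ha
      · exact h.symm
    exact centralizer_eq_top_iff_subset.1 htop rfl
  · intro h
    exact (mem_center_iff.1 h g).symm

end AbelianPrimeIndex

theorem not_mem_center_iff_centralizer_ne_top {x : G} :
    x ∉ center G ↔ centralizer {x} ≠ ⊤ := by
  rw [Ne, centralizer_eq_top_iff_subset, Set.singleton_subset_iff]
  rfl

theorem card_commutator_eq_prime_pow [Finite G] {p n : ℕ} (hp : p.Prime)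
    (hcard : (center G).index = p ^ n) : ∃ k, Nat.card (commutator G) = p ^ k := by
  have := Fact.mk hp
  apply IsPGroup.iff_card.1
  rintro ⟨x, hx⟩
  refine ⟨n, ?_⟩
  have h : x ∈ (MonoidHom.transferCenterPow G).ker := by
    refine Subgroup.commutator_le.2 (fun a _ b _ => ?_) hx
    rw [MonoidHom.mem_ker, map_commutatorElement, commutatorElement_eq_one_iff_mul_comm,
      mul_comm']
  rw [MonoidHom.mem_ker] at h
  have h2 := congrArg Subtype.val h
  rw [MonoidHom.transferCenterPow_apply, hcard] at h2
  exact Subtype.ext h2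

section PrimeCube

variable {p : ℕ} (hp : p.Prime) (hcard : (center G).index = p ^ 3)

include hp hcard

theorem relIndex_center_centralizer {x : G} (hx : x ∉ center G) :
    ((center G).relIndex (centralizer {x}) = p ∧ (centralizer {x}).index = p ^ 2) ∨
    ((center G).relIndex (centralizer {x}) = p ^ 2 ∧ (centralizer {x}).index = p) := by
  have h := relIndex_mul_index (center_le_centralizer ({x} : Set G))
  have h1 : (center G).relIndex (centralizer {x}) ≠ 1 := fun h1 =>
    hx (relIndex_eq_one.1 h1 (mem_centralizer_singleton_iff.2 rfl))
  have h2 : (centralizer {x}).index ≠ 1 := fun h2 =>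
    not_mem_center_iff_centralizer_ne_top.1 hx (index_eq_one.1 h2)
  rw [hcard] at h
  obtain ⟨k, hk, hk'⟩ := (Nat.dvd_prime_pow hp).1 (Dvd.intro _ h)
  rw [hk'] at h h1 ⊢
  have hpos := hp.pos
  have hk3 : k ≠ 3 := by
    rintro rfl
    exact h2 (Nat.eq_of_mul_eq_mul_left (pow_pos hpos 3) (by rw [h, mul_one]))
  have hk0 : k ≠ 0 := by
    rintro rfl
    exact h1 (pow_zero p)
  obtain rfl | rfl : k = 1 ∨ k = 2 := by omega
  · left
    refine ⟨pow_one p, Nat.eq_of_mul_eq_mul_left hpos ?_⟩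
    rw [← pow_succ', ← h, pow_one]
  · right
    refine ⟨rfl, Nat.eq_of_mul_eq_mul_left (pow_pos hpos 2) ?_⟩
    rw [h]
    ring

theorem centralizer_comm {x : G} (hx : x ∉ center G) :
    ∀ y ∈ centralizer {x}, ∀ w ∈ centralizer {x}, y * w = w * y := by
  intro y hy w hw
  by_contra hyw
  set C := centralizer {x}
  set D := C ⊓ centralizer (C : Set G)
  set E := C ⊓ centralizer {y}
  have hxC : x ∈ C := mem_centralizer_singleton_iff.2 rfl
  have hZD : center G ≤ D := le_inf (center_le_centralizer _) (center_le_centralizer _)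
  have hDE : D ≤ E := inf_le_inf_left _ (centralizer_le (Set.singleton_subset_iff.2 hy))
  have hEC : E ≤ C := inf_le_left
  have e1 := relIndex_mul_relIndex _ _ _ hZD hDE
  have e2 := relIndex_mul_relIndex _ _ _ (hZD.trans hDE) hEC
  have e3 := relIndex_mul_index ((hZD.trans hDE).trans hEC)
  have d : ∀ n, n ∣ p ^ 3 → n ≠ 1 → p ∣ n := by
    intro n hn hn1
    obtain ⟨k, -, rfl⟩ := (Nat.dvd_prime_pow hp).1 hn
    exact dvd_pow_self p fun hk => hn1 (by rw [hk, pow_zero])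
  rw [← e2, ← e1, hcard] at e3
  have f1 : (center G).relIndex D ≠ 1 := fun h => hx <| relIndex_eq_one.1 h
    ⟨hxC, mem_centralizer_iff.2 fun c hc => mem_centralizer_singleton_iff.1 hc⟩
  have f2 : D.relIndex E ≠ 1 := fun h => hyw <| by
    have : y ∈ D := relIndex_eq_one.1 h ⟨hy, mem_centralizer_singleton_iff.2 rfl⟩
    exact (mem_centralizer_iff.1 this.2 w hw).symm
  have f3 : E.relIndex C ≠ 1 := fun h => hyw <| by
    have : w ∈ E := relIndex_eq_one.1 h hw
    exact (mem_centralizer_singleton_iff.1 this.2).symm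
  have f4 : C.index ≠ 1 := fun h =>
    not_mem_center_iff_centralizer_ne_top.1 hx (index_eq_one.1 h)
  have g1 := d _ (e3 ▸ ((Dvd.intro _ rfl).mul_right _).mul_right _) f1
  have g2 := d _ (e3 ▸ ((Dvd.intro_left _ rfl).mul_right _).mul_right _) f2
  have g3 := d _ (e3 ▸ (Dvd.intro_left _ rfl).mul_right _) f3
  have g4 := d _ (e3 ▸ Dvd.intro_left _ rfl) f4
  have h := mul_dvd_mul (mul_dvd_mul (mul_dvd_mul g1 g2) g3) g4
  rw [e3, show p * p * p * p = p ^ 4 by ring] at h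
  exact absurd ((Nat.pow_dvd_pow_iff_le_right hp.one_lt).1 h) (by norm_num)

theorem centralizer_eq_of_mem {x w : G} (hx : x ∉ center G) (hw : w ∉ center G)
    (hwx : w ∈ centralizer {x}) : centralizer {w} = centralizer {x} := by
  have hxw : x ∈ centralizer {w} := by
    rw [mem_centralizer_singleton_iff] at hwx ⊢
    exact hwx.symm
  apply le_antisymm <;> intro u hu <;> rw [mem_centralizer_singleton_iff]
  · exact centralizer_comm hp hcard hw u hu x hxw
  · exact centralizer_comm hp hcard hx u hu w hwx

theorem centralizer_eq_of_index_eq {x y : G} (hx : x ∉ center G) (hy : y ∉ center G)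
    (hxi : (centralizer {x}).index = p) (hyi : (centralizer {y}).index = p) :
    centralizer {x} = centralizer {y} := by
  by_contra hne
  have hle : centralizer {x} ⊓ centralizer {y} ≤ center G := by
    rintro w ⟨hwx, hwy⟩
    by_contra hw
    exact hne ((centralizer_eq_of_mem hp hcard hx hw hwx).symm.trans
      (centralizer_eq_of_mem hp hcard hy hw hwy))
  have heq := le_antisymm hle (le_inf (center_le_centralizer _) (center_le_centralizer _))
  have h := index_inf_le (H := centralizer {x}) (K := centralizer {y})
  rw [heq, hcard, hxi, hyi, ← sq] at h
  exact absurd ((Nat.pow_le_pow_iff_right hp.one_lt).1 h) (by norm_num)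

theorem exists_abelian_normal_prime_index_iff [Finite G] :
    (∃ N : Subgroup G, N.Normal ∧ (∀ x ∈ N, ∀ y ∈ N, x * y = y * x) ∧ N.index.Prime) ↔
      ∃ x ∉ center G, (centralizer {x}).Normal ∧ (centralizer {x}).index = p := by
  constructor
  · rintro ⟨N, hn, hN, hNp⟩
    have hZN : center G ≤ N := by
      intro z hz
      by_contra hzN
      have h1 : centralizer (N : Set G) = ⊤ :=
        eq_top_of_index_prime hNp
          (fun a ha => mem_centralizer_iff.2 fun b hb => hN b hb a ha) hzN
          (center_le_centralizer _ hz)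
      have h2 := eq_top_of_index_prime hNp (centralizer_eq_top_iff_subset.1 h1) hzN hz
      rw [h2, index_top] at hcard
      exact (Nat.one_lt_pow (by norm_num) hp.one_lt).ne hcard
    have hNi : N.index = p := (Nat.prime_dvd_prime_iff_eq hNp hp).1
      (hNp.dvd_of_dvd_pow (hcard ▸ index_dvd_of_le hZN))
    obtain ⟨x, hxN, hx⟩ : ∃ x ∈ N, x ∉ center G := by
      by_contra! h
      rw [le_antisymm hZN h, hNi] at hcard
      exact absurd (Nat.pow_right_injective hp.two_le
        (show p ^ 1 = p ^ 3 by rw [pow_one, ← hcard])) (by norm_num)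
    have hle : N ≤ centralizer {x} := fun a ha =>
      mem_centralizer_singleton_iff.2 (hN a ha x hxN)
    have heq : centralizer {x} = N := by
      refine le_antisymm (fun a ha => ?_) hle
      by_contra haN
      exact not_mem_center_iff_centralizer_ne_top.1 hx (eq_top_of_index_prime hNp hle haN ha)
    exact ⟨x, hx, heq ▸ hn, heq ▸ hNi⟩
  · rintro ⟨x, hx, hn, hi⟩
    exact ⟨_, hn, centralizer_comm hp hcard hx, hi ▸ hp⟩

theorem centralizer_normal_of_index_eq {x : G} (hi : (centralizer {x}).index = p) :
    (centralizer {x}).Normal := by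
  let π := QuotientGroup.mk' (center G)
  have hker : π.ker ≤ centralizer {x} := by
    rw [QuotientGroup.ker_mk']
    exact center_le_centralizer _
  have h : ((centralizer {x}).map π).Normal := by
    apply normal_of_index_eq_minFac_card
    rw [index_map_eq _ (QuotientGroup.mk'_surjective _) hker, hi]
    change p = (center G).index.minFac
    rw [hcard, hp.pow_minFac (by norm_num)]
  rw [← comap_map_eq_self hker]
  exact h.comap π

end PrimeCube

section Counting

variable [Finite G]

theorem ncard_cent_eq_ncard_image_add_one :
    (Cent G).ncard =
      ((fun x : G => centralizer {x}) '' {x | x ∉ center G}).ncard + 1 := by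
  have h : Cent G = insert ⊤ ((fun x : G => centralizer {x}) '' {x | x ∉ center G}) := by
    ext H
    simp only [Cent, Set.mem_range, Set.mem_insert_iff, Set.mem_image, Set.mem_ofPred_eq]
    constructor
    · rintro ⟨x, rfl⟩
      by_cases hx : centralizer {x} = ⊤
      · exact Or.inl hx
      · exact Or.inr ⟨x, not_mem_center_iff_centralizer_ne_top.2 hx, rfl⟩
    · rintro (rfl | ⟨x, -, rfl⟩)
      · exact ⟨1, by simp [centralizer_eq_top_iff_subset, one_mem]⟩
      · exact ⟨x, rfl⟩
  rw [h, Set.ncard_insert_of_notMem]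
  rintro ⟨x, hx, htop⟩
  exact not_mem_center_iff_centralizer_ne_top.1 hx htop

variable {p : ℕ} (hp : p.Prime) (hcard : (center G).index = p ^ 3)

include hp hcard

theorem ncard_fiber_centralizer {x : G} (hx : x ∉ center G) :
    {w | w ∉ center G ∧ centralizer {w} = centralizer {x}}.ncard + Nat.card (center G) =
      (center G).relIndex (centralizer {x}) * Nat.card (center G) := by
  have h : {w | w ∉ center G ∧ centralizer {w} = centralizer {x}} =
      (centralizer {x} : Set G) \ (center G : Set G) := by
    ext w
    constructor
    · rintro ⟨hw, h⟩
      exact ⟨h ▸ mem_centralizer_singleton_iff.2 rfl, hw⟩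
    · rintro ⟨hw, h⟩
      exact ⟨h, centralizer_eq_of_mem hp hcard hx h hw⟩
  have h2 := relIndex_mul_relIndex ⊥ (center G) (centralizer {x}) bot_le
    (center_le_centralizer _)
  rw [relIndex_bot_left, relIndex_bot_left] at h2
  rw [h, mul_comm, h2]
  exact Set.ncard_sdiff_add_ncard_of_subset (center_le_centralizer {x})

theorem sum_relIndex_center_centralizer :
    ∃ S : Finset (Subgroup G), S.card + 1 = (Cent G).ncard ∧
      (∀ H, H ∈ S ↔ ∃ x ∉ center G, centralizer {x} = H) ∧
      p ^ 3 + S.card = 1 + ∑ H ∈ S, (center G).relIndex H := by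
  classical
  have := Fintype.ofFinite G
  let f : G → Subgroup G := fun x => centralizer {x}
  let s : Finset G := Finset.univ.filter (· ∉ center G)
  have hmem : ∀ H, H ∈ s.image f ↔ ∃ x ∉ center G, centralizer {x} = H := by
    simp [s, f]
  refine ⟨s.image f, ?_, hmem, ?_⟩
  · rw [ncard_cent_eq_ncard_image_add_one, ← Set.ncard_coe_finset]
    congr 3
    simp [s, f]
  · have hs : s.card = ∑ H ∈ s.image f, {a ∈ s | f a = H}.card :=
      Finset.card_eq_sum_card_fiberwise fun x hx => Finset.mem_coe.2 (Finset.mem_image_of_mem f hx)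
    have hfib : ∀ H ∈ s.image f, {a ∈ s | f a = H}.card + Nat.card (center G) =
        (center G).relIndex H * Nat.card (center G) := by
      intro H hH
      obtain ⟨x, hx, rfl⟩ := (hmem H).1 hH
      rw [← ncard_fiber_centralizer hp hcard hx, ← Set.ncard_coe_finset]
      congr 3
      simp [s, f]
    have htot : s.card + Nat.card (center G) = p ^ 3 * Nat.card (center G) := by
      rw [← hcard, index_mul_card, ← Set.ncard_coe_finset]
      have : (s : Set G) = Set.univ \ (center G : Set G) := by
        ext
        simp [s]
      rw [this]
      exact (Set.ncard_sdiff_add_ncard_of_subset (Set.subset_univ (center G : Set G))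
        Set.finite_univ).trans (Set.ncard_univ G)
    have hsum := Finset.sum_congr rfl hfib
    rw [Finset.sum_add_distrib, ← hs, Finset.sum_const, smul_eq_mul, ← Finset.sum_mul] at hsum
    have hz : 0 < Nat.card (center G) := Nat.card_pos
    apply Nat.eq_of_mul_eq_mul_right hz
    rw [add_mul, add_mul, ← htot, ← hsum]
    ring

theorem ncard_cent_of_exists_index_eq {x : G} (hx : x ∉ center G)
    (hi : (centralizer {x}).index = p) : (Cent G).ncard = p ^ 2 + 2 := by
  classical
  obtain ⟨S, hS, hmem, hsum⟩ := sum_relIndex_center_centralizer hp hcard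
  have hxS : centralizer {x} ∈ S := (hmem _).2 ⟨x, hx, rfl⟩
  have hrest : ∀ H ∈ S.erase (centralizer {x}), (center G).relIndex H = p := by
    intro H hH
    obtain ⟨hne, hHS⟩ := Finset.mem_erase.1 hH
    obtain ⟨y, hy, rfl⟩ := (hmem H).1 hHS
    rcases relIndex_center_centralizer hp hcard hy with h | h
    · exact h.1
    · exact absurd (centralizer_eq_of_index_eq hp hcard hy hx h.2 hi) hne
  have hxr : (center G).relIndex (centralizer {x}) = p ^ 2 := by
    rcases relIndex_center_centralizer hp hcard hx with h | h
    · have h2 : p ^ 2 = p ^ 1 := by rw [← h.2, hi, pow_one]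
      exact absurd (Nat.pow_right_injective hp.two_le h2) (by norm_num)
    · exact h.1
  rw [← Finset.add_sum_erase _ _ hxS, Finset.sum_congr rfl hrest, Finset.sum_const, hxr,
    smul_eq_mul] at hsum
  have hc := Finset.card_erase_add_one hxS
  rw [← hS, ← hc]
  rw [← hc] at hsum
  obtain ⟨q, rfl⟩ := Nat.exists_eq_add_of_lt hp.one_lt
  have hq : (S.erase (centralizer {x})).card * (q + 1) = (1 + q + 1) ^ 2 * (q + 1) := by
    linarith
  have := Nat.eq_of_mul_eq_mul_right q.succ_pos hq
  omega

theorem ncard_cent_of_forall_index_ne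
    (h : ∀ x ∉ center G, (centralizer {x}).index ≠ p) :
    (Cent G).ncard = p * (p + 1) + 2 := by
  classical
  obtain ⟨S, hS, hmem, hsum⟩ := sum_relIndex_center_centralizer hp hcard
  have hall : ∀ H ∈ S, (center G).relIndex H = p := by
    intro H hH
    obtain ⟨y, hy, rfl⟩ := (hmem H).1 hH
    exact ((relIndex_center_centralizer hp hcard hy).resolve_right
      fun h' => h y hy h'.2).1
  rw [Finset.sum_congr rfl hall, Finset.sum_const, smul_eq_mul] at hsum
  rw [← hS]
  obtain ⟨q, rfl⟩ := Nat.exists_eq_add_of_lt hp.one_lt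
  have hq : S.card * (q + 1) = ((1 + q + 1) * (1 + q + 1 + 1) + 1) * (q + 1) := by
    linarith
  have := Nat.eq_of_mul_eq_mul_right q.succ_pos hq
  omega

end Counting

end Aux

open Subgroup in
/-- If `|G/Z(G)| = p³` for a prime `p`, then `G` is a CG-group iff `G` has an abelian
normal subgroup of prime index. -/
theorem isCGGroup_iff_abelian_normal_prime_index (G : Type*) [Group G] [Finite G]
    (p : ℕ) (hp : p.Prime)
    (hcard : Nat.card (G ⧸ Subgroup.center G) = p ^ 3) :
    IsCGGroup G ↔ ∃ N : Subgroup G, N.Normal ∧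
      (∀ x ∈ N, ∀ y ∈ N, x * y = y * x) ∧ N.index.Prime := by
  change (center G).index = p ^ 3 at hcard
  rw [exists_abelian_normal_prime_index_iff hp hcard, IsCGGroup]
  constructor
  · intro hG
    by_contra! hne
    rw [ncard_cent_of_forall_index_ne hp hcard fun x hx hi =>
      hne x hx (centralizer_normal_of_index_eq hp hcard hi) hi] at hG
    obtain ⟨k, hk⟩ := card_commutator_eq_prime_pow hp hcard
    rw [hk, Nat.add_right_cancel_iff] at hG
    have hco : Nat.Coprime (p + 1) (p ^ k) :=
      Nat.Coprime.pow_right k (Nat.coprime_self_add_left.2 (Nat.coprime_one_left p))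
    have := hco.eq_one_of_dvd (Dvd.intro_left _ hG)
    exact hp.ne_zero (by omega)
  · rintro ⟨x, hx, hn, hi⟩
    obtain ⟨g, hg⟩ : ∃ g, g ∉ centralizer {x} := by
      by_contra! h
      exact not_mem_center_iff_centralizer_ne_top.1 hx (eq_top_iff' _ |>.2 h)
    rw [ncard_cent_of_exists_index_eq hp hcard hx hi,
      card_commutator_eq_relIndex_center (centralizer_comm hp hcard hx) (hi ▸ hp) hg]
    have h := relIndex_mul_index (center_le_centralizer ({x} : Set G))
    rw [hi, hcard, pow_succ] at h
    rw [Nat.eq_of_mul_eq_mul_right hp.pos h]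
end
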